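/- Let n ≥ 2 and 2 ≤ m ≤ n. Let S be a real symmetric n×n matrix in the Gårding cone K_m(n), let S′ denote the symmetric (n−1)×(n−1) matrix obtained from S by deleting the last row and column, let A be a real symmetric (n−1)×(n−1) matrix, and let λ ≤ 0 be a real number such that the matrix S′ + λA is negative semidefinite. Then λ < 0 and A belongs to the Gårding cone K_{m−1}(n−1). -/

import Mathlib

open Matrix

/-- The `p`-trace of a square real matrix: the sum of all `p × p` principal minors.
    `ptrace 0 S = 1`. -/
noncomputable def ptrace {ι : Type*} [Fintype ι] (p : ℕ) (S : Matrix ι ι ℝ) : ℝ := by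
  classical
  exact ∑ t ∈ Finset.univ.powersetCard p,
    (S.submatrix (Subtype.val : {x // x ∈ t} → ι) Subtype.val).det

/-- The Gårding cone `K_m(n)`: real symmetric `n × n` matrices with `T_p > 0`
    for `p = 1, …, m`. -/
noncomputable def gardingCone (n m : ℕ) : Set (Matrix (Fin n) (Fin n) ℝ) :=
  {S | S.IsSymm ∧ ∀ p, 1 ≤ p → p ≤ m → 0 < ptrace p S}

section Newton

open Polynomial

/-- By Rolle's theorem, the derivative of a real-rooted polynomial is real-rooted. -/
theorem Polynomial.Splits.derivative_real {f : ℝ[X]} (hf : f.Splits) : f.derivative.Splits := by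
  rw [splits_iff_card_roots] at hf ⊢
  have h₁ := card_roots_le_derivative f
  have h₂ := card_roots' (derivative f)
  have h₃ := natDegree_derivative_le f
  rcases Nat.eq_zero_or_pos f.natDegree with h0 | h0
  · omega
  · omega

theorem Polynomial.Splits.iterate_derivative_real {f : ℝ[X]} (hf : f.Splits) (k : ℕ) :
    (derivative^[k] f).Splits := by
  induction k with
  | zero => exact hf
  | succ k ih =>
    rw [Function.iterate_succ_apply']
    exact ih.derivative_real

theorem Polynomial.Splits.two_mul_coeff_zero_mul_coeff_two_le {f : ℝ[X]} (hf : f.Splits) :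
    2 * (f.coeff 0 * f.coeff 2) ≤ f.coeff 1 ^ 2 := by
  have key : ∀ m : Multiset ℝ,
      2 * ((m.map (X + C ·)).prod.coeff 0 * (m.map (X + C ·)).prod.coeff 2) ≤
        (m.map (X + C ·)).prod.coeff 1 ^ 2 := by
    intro m
    induction m using Multiset.induction_on with
    | empty => simp [coeff_one]
    | cons r m ih =>
      simp only [Multiset.map_cons, Multiset.prod_cons, add_mul, coeff_add, coeff_C_mul]
      rw [coeff_X_mul_zero, coeff_X_mul _ 0, coeff_X_mul _ 1]
      nlinarith [mul_le_mul_of_nonneg_left ih (sq_nonneg r),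
        sq_nonneg ((m.map (X + C ·)).prod.coeff 0)]
  obtain ⟨m, hm⟩ := splits_iff_exists_multiset'.mp hf
  rw [hm]
  simp only [coeff_C_mul]
  nlinarith [mul_le_mul_of_nonneg_left (key m) (sq_nonneg f.leadingCoeff)]

/-- A weak form of Newton's inequalities: the coefficients of a real-rooted polynomial are
log-concave. -/
theorem Polynomial.Splits.coeff_mul_coeff_le {f : ℝ[X]} (hf : f.Splits) (k : ℕ) :
    f.coeff k * f.coeff (k + 2) ≤ f.coeff (k + 1) ^ 2 := by
  have h := (hf.iterate_derivative_real k).two_mul_coeff_zero_mul_coeff_two_le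
  simp only [coeff_iterate_derivative, nsmul_eq_mul] at h
  have e0 : (0 + k).descFactorial k = k.factorial := by simp [Nat.descFactorial_self]
  have e1 : (1 + k).descFactorial k = (k + 1) * k.factorial := by
    have := Nat.factorial_mul_descFactorial (show k ≤ 1 + k by omega)
    rw [show 1 + k - k = 1 by omega, add_comm 1 k, Nat.factorial_one, one_mul,
      Nat.factorial_succ] at this
    rw [add_comm 1 k, this]
  have e2 : 2 * (2 + k).descFactorial k = (k + 2) * ((k + 1) * k.factorial) := by
    have := Nat.factorial_mul_descFactorial (show k ≤ 2 + k by omega)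
    rw [show 2 + k - k = 2 by omega, add_comm 2 k, Nat.factorial_two,
      Nat.factorial_succ, Nat.factorial_succ] at this
    rw [add_comm 2 k, this]
  have e2' : (2 : ℝ) * ((2 + k).descFactorial k : ℝ) = (k + 2) * ((k + 1) * k.factorial) := by
    exact_mod_cast e2
  rw [e0, e1] at h
  push_cast at h
  rw [zero_add, add_comm 1 k, add_comm 2 k] at h
  rw [add_comm 2 k] at e2'
  have hfac : (0 : ℝ) < k.factorial := by exact_mod_cast k.factorial_pos
  have hpos : (0 : ℝ) < (k + 1) * (k.factorial : ℝ) ^ 2 := by positivity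
  have h' : ((k : ℝ) + 2) * (f.coeff k * f.coeff (k + 2)) ≤ (k + 1) * f.coeff (k + 1) ^ 2 := by
    refine le_of_mul_le_mul_left ?_ hpos
    calc _ = (k.factorial * f.coeff k) * (((k + 2) * ((k + 1) * k.factorial)) *
            f.coeff (k + 2)) := by ring
      _ ≤ ((k + 1) * k.factorial * f.coeff (k + 1)) ^ 2 := by rw [← e2']; linarith
      _ = _ := by ring
  have hk : (0 : ℝ) ≤ k := k.cast_nonneg
  by_contra! hlt
  nlinarith [sq_nonneg (f.coeff (k + 1)), mul_nonneg hk (sub_nonneg.2 hlt.le)]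

end Newton

section PTrace

variable {ι : Type*} [Fintype ι]

theorem ptrace_eq [DecidableEq ι] (p : ℕ) (S : Matrix ι ι ℝ) :
    ptrace p S = ∑ t ∈ Finset.univ.powersetCard p,
      (S.submatrix (Subtype.val : {x // x ∈ t} → ι) Subtype.val).det := by
  unfold ptrace
  refine Finset.sum_congr rfl fun t _ => ?_
  congr!

theorem ptrace_zero (S : Matrix ι ι ℝ) : ptrace 0 S = 1 := by
  classical
  simp [ptrace_eq]

theorem ptrace_eq_zero_of_card_lt {p : ℕ} (hp : Fintype.card ι < p) (S : Matrix ι ι ℝ) :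
    ptrace p S = 0 := by
  classical
  rw [ptrace_eq, Finset.powersetCard_eq_empty.2 (by simpa using hp), Finset.sum_empty]

theorem ptrace_smul (p : ℕ) (c : ℝ) (S : Matrix ι ι ℝ) :
    ptrace p (c • S) = c ^ p * ptrace p S := by
  classical
  rw [ptrace_eq, ptrace_eq, Finset.mul_sum]
  refine Finset.sum_congr rfl fun t ht => ?_
  rw [Matrix.submatrix_smul, Pi.smul_apply, Pi.smul_apply, Matrix.det_smul, Fintype.card_coe,
    (Finset.mem_powersetCard.1 ht).2]

theorem charpoly_coeff_eq_ptrace [DecidableEq ι] (S : Matrix ι ι ℝ) {p : ℕ}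
    (hp : p ≤ Fintype.card ι) :
    S.charpoly.coeff (Fintype.card ι - p) = (-1) ^ p * ptrace p S := by
  rw [Matrix.charpoly_coeff_eq_sum_minors S p hp, ptrace_eq]

theorem ptrace_eq_of_charpoly_eq [DecidableEq ι] {S S' : Matrix ι ι ℝ}
    (h : S.charpoly = S'.charpoly) (p : ℕ) : ptrace p S = ptrace p S' := by
  rcases le_or_gt p (Fintype.card ι) with hp | hp
  · have := charpoly_coeff_eq_ptrace S hp
    rw [h, charpoly_coeff_eq_ptrace S' hp] at this
    exact (mul_left_cancel₀ (pow_ne_zero p (by norm_num)) this).symm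
  · rw [ptrace_eq_zero_of_card_lt hp, ptrace_eq_zero_of_card_lt hp]

/-- Weak Newton inequalities for the `p`-traces of a symmetric matrix. -/
theorem ptrace_mul_ptrace_le {S : Matrix ι ι ℝ} (hS : S.IsHermitian) (p : ℕ) :
    ptrace p S * ptrace (p + 2) S ≤ ptrace (p + 1) S ^ 2 := by
  classical
  rcases le_or_gt (p + 2) (Fintype.card ι) with hp | hp
  · have h := hS.splits_charpoly.coeff_mul_coeff_le (Fintype.card ι - (p + 2))
    rw [show Fintype.card ι - (p + 2) + 2 = Fintype.card ι - p by omega,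
      show Fintype.card ι - (p + 2) + 1 = Fintype.card ι - (p + 1) by omega,
      charpoly_coeff_eq_ptrace S hp, charpoly_coeff_eq_ptrace S (by omega),
      charpoly_coeff_eq_ptrace S (by omega), mul_pow, ← pow_mul, mul_comm (p + 1) 2,
      pow_mul] at h
    have hs : ((-1 : ℝ) ^ p) * (-1) ^ p = 1 := by rw [← mul_pow]; norm_num
    calc _ = ((-1 : ℝ) ^ p * (-1) ^ p) * (ptrace p S * ptrace (p + 2) S) := by rw [hs, one_mul]
      _ = (-1) ^ (p + 2) * ptrace (p + 2) S * ((-1) ^ p * ptrace p S) := by ring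
      _ ≤ _ := h
      _ = _ := by norm_num
  · rw [ptrace_eq_zero_of_card_lt hp, mul_zero]
    positivity

/-- The sum of the `p × p` principal minors of `S` that avoid the index `i`. -/
noncomputable def ptraceAvoiding [DecidableEq ι] (i : ι) (p : ℕ) (S : Matrix ι ι ℝ) : ℝ :=
  ∑ t ∈ (Finset.univ.erase i).powersetCard p,
    (S.submatrix (Subtype.val : {x // x ∈ t} → ι) Subtype.val).det

theorem ptraceAvoiding_zero [DecidableEq ι] (i : ι) (S : Matrix ι ι ℝ) :
    ptraceAvoiding i 0 S = 1 := by
  simp [ptraceAvoiding]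

theorem det_submatrix_add_single_of_notMem {κ : Type*} [DecidableEq κ]
    (S : Matrix κ κ ℝ) {i : κ} (c : ℝ) {t : Finset κ} (hi : i ∉ t) :
    ((S + Matrix.single i i c).submatrix (Subtype.val : {x // x ∈ t} → κ) Subtype.val).det =
      (S.submatrix (Subtype.val : {x // x ∈ t} → κ) Subtype.val).det := by
  congr 1
  ext ⟨j, hj⟩ ⟨k, hk⟩
  have : i ≠ j := fun h => hi (h ▸ hj)
  simp [this]

theorem det_submatrix_insert_add_single [DecidableEq ι] (S : Matrix ι ι ℝ) {i : ι} (c : ℝ)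
    {t : Finset ι} (hi : i ∉ t) :
    ((S + Matrix.single i i c).submatrix
        (Subtype.val : {x // x ∈ insert i t} → ι) Subtype.val).det =
      (S.submatrix (Subtype.val : {x // x ∈ insert i t} → ι) Subtype.val).det +
        c * (S.submatrix (Subtype.val : {x // x ∈ t} → ι) Subtype.val).det := by
  rw [← Matrix.det_piecewise_one_eq_submatrix_det, ← Matrix.det_piecewise_one_eq_submatrix_det,
    ← Matrix.det_piecewise_one_eq_submatrix_det S t]
  set M : Matrix ι ι ℝ := Matrix.of (t.piecewise S.row (1 : Matrix ι ι ℝ).row) with hM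
  have h1 : Matrix.of ((insert i t).piecewise (S + Matrix.single i i c).row
      (1 : Matrix ι ι ℝ).row) = M.updateRow i (S i + c • Pi.single i 1) := by
    ext j k
    by_cases hj : j = i
    · subst hj
      simp [Matrix.single_apply, Pi.single_apply, eq_comm]
    · have : i ≠ j := Ne.symm hj
      by_cases hjt : j ∈ t <;> simp [hM, hj, hjt, this]
  have h2 : Matrix.of ((insert i t).piecewise S.row (1 : Matrix ι ι ℝ).row) =
      M.updateRow i (S i) := by
    ext j k
    by_cases hj : j = i
    · subst hj
      simp
    · simp [hM, hj, Finset.piecewise]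
  have h3 : M.updateRow i (Pi.single i 1) = M := by
    ext j k
    by_cases hj : j = i
    · subst hj
      simp [hM, hi, Matrix.one_apply, Pi.single_apply, eq_comm]
    · simp [hj]
  rw [h1, h2, Matrix.det_updateRow_add, Matrix.det_updateRow_smul, h3]

theorem ptrace_succ_add_single [DecidableEq ι] (S : Matrix ι ι ℝ) (i : ι) (c : ℝ) (p : ℕ) :
    ptrace (p + 1) (S + Matrix.single i i c) =
      ptrace (p + 1) S + c * ptraceAvoiding i p S := by
  have hi : i ∉ (Finset.univ : Finset ι).erase i := by simp
  have hnot : ∀ {q : ℕ} {t}, t ∈ ((Finset.univ : Finset ι).erase i).powersetCard q → i ∉ t :=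
    fun ht h => hi ((Finset.mem_powersetCard.1 ht).1 h)
  have hdisj : Disjoint (((Finset.univ : Finset ι).erase i).powersetCard (p + 1))
      ((((Finset.univ : Finset ι).erase i).powersetCard p).image (insert i)) := by
    rw [Finset.disjoint_left]
    intro t ht ht'
    obtain ⟨s, -, rfl⟩ := Finset.mem_image.1 ht'
    exact hnot ht (Finset.mem_insert_self _ _)
  have hinj : Set.InjOn (insert i)
      (((Finset.univ : Finset ι).erase i).powersetCard p : Set (Finset ι)) := by
    intro s hs t ht hst
    rw [← Finset.erase_insert (hnot hs), hst, Finset.erase_insert (hnot ht)]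
  rw [ptrace_eq, ptrace_eq, ptraceAvoiding, ← Finset.insert_erase (Finset.mem_univ i),
    Finset.powersetCard_succ_insert hi, Finset.sum_union hdisj, Finset.sum_union hdisj,
    Finset.sum_image hinj, Finset.sum_image hinj, Finset.insert_erase (Finset.mem_univ i),
    Finset.sum_congr rfl fun t ht => det_submatrix_add_single_of_notMem S c (hnot ht),
    Finset.sum_congr rfl fun t ht => det_submatrix_insert_add_single S c (hnot ht),
    Finset.sum_add_distrib, ← Finset.mul_sum, add_assoc]

end PTrace

section Cone

theorem mul_le_mul_of_forall_pencil_le {a b c x y z : ℝ} (hx : 0 < x) (hy : 0 < y)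
    (h : b * x ≤ a * y)
    (hN : ∀ t, (a + t * x) * (c + t * z) ≤ (b + t * y) ^ 2) : c * y ≤ b * z := by
  by_contra! hlt
  set δ := c - b / y * z with hδ
  have hδ0 : 0 < δ := by
    have : δ * y = c * y - b * z := by rw [hδ]; field_simp
    exact pos_of_mul_pos_left (by linarith) hy.le
  have ha : 0 ≤ a - b / y * x := by
    have : (a - b / y * x) * y = a * y - b * x := by field_simp
    exact nonneg_of_mul_nonneg_left (by linarith) hy
  have hD : 0 < y ^ 2 + x * |z| := by positivity
  set s := x * δ / (2 * (y ^ 2 + x * |z|)) with hs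
  have hs0 : 0 < s := by positivity
  have hs1 : s * (y ^ 2 + x * |z|) = x * δ / 2 := by rw [hs]; field_simp
  have hz : s * |z| ≤ δ / 2 := by
    refine le_of_mul_le_mul_left ?_ hx
    nlinarith [mul_pos hs0 (sq_pos_of_pos hy)]
  have hz' : -(s * |z|) ≤ s * z := by nlinarith [neg_abs_le z]
  have hpos : 0 ≤ δ + s * z := by linarith
  have hNt := hN (-(b / y) + s)
  have e1 : b + (-(b / y) + s) * y = s * y := by field_simp; ring
  have e2 : a + (-(b / y) + s) * x = (a - b / y * x) + s * x := by ring
  have e3 : c + (-(b / y) + s) * z = δ + s * z := by rw [hδ]; ring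
  rw [e1, e2, e3] at hNt
  have h1 : s * (x * (δ + s * z)) ≤ s * (s * y ^ 2) := by nlinarith [mul_nonneg ha hpos]
  have h2 := le_of_mul_le_mul_left h1 hs0
  nlinarith [mul_le_mul_of_nonneg_left hz' hx.le, mul_pos hx hδ0]

variable {ι : Type*} [Fintype ι] [DecidableEq ι]

/-- Deleting an index maps `K_m` to `K_{m-1}`. -/
theorem ptraceAvoiding_pos {S : Matrix ι ι ℝ} (hS : S.IsHermitian) {m : ℕ}
    (hpos : ∀ p, 1 ≤ p → p ≤ m → 0 < ptrace p S) (i : ι) {p : ℕ} (hp : p + 1 ≤ m) :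
    0 < ptraceAvoiding i p S := by
  have hH : ∀ t : ℝ, (S + Matrix.single i i t).IsHermitian := fun t =>
    hS.add (by ext j k; simp [Matrix.single_apply, and_comm])
  have key : ∀ q, q + 2 ≤ m → 0 < ptraceAvoiding i q S ∧
      ptrace (q + 2) S * ptraceAvoiding i q S ≤
        ptrace (q + 1) S * ptraceAvoiding i (q + 1) S := by
    intro q
    induction q with
    | zero =>
      intro _
      have hN := ptrace_mul_ptrace_le (hH (-ptrace 1 S)) 0
      rw [ptrace_zero, ptrace_succ_add_single, ptrace_succ_add_single, ptraceAvoiding_zero] at hN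
      rw [ptraceAvoiding_zero]
      norm_num at hN ⊢
      linarith
    | succ q ih =>
      intro hq
      obtain ⟨hx, hle⟩ := ih (by omega)
      have hy : 0 < ptraceAvoiding i (q + 1) S :=
        pos_of_mul_pos_right ((mul_pos (hpos (q + 2) (by omega) (by omega)) hx).trans_le hle)
          (hpos (q + 1) (by omega) (by omega)).le
      refine ⟨hy, mul_le_mul_of_forall_pencil_le hx hy hle fun t => ?_⟩
      have hN := ptrace_mul_ptrace_le (hH t) (q + 1)
      simpa only [ptrace_succ_add_single] using hN
  cases p with
  | zero => rw [ptraceAvoiding_zero]; exact one_pos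
  | succ q =>
    obtain ⟨hx, hle⟩ := key q (by omega)
    exact pos_of_mul_pos_right ((mul_pos (hpos (q + 2) (by omega) (by omega)) hx).trans_le hle)
      (hpos (q + 1) (by omega) (by omega)).le

theorem ptrace_add_diagonal_pos {S : Matrix ι ι ℝ} (hS : S.IsHermitian) {m : ℕ}
    (hpos : ∀ p, 1 ≤ p → p ≤ m → 0 < ptrace p S) {d : ι → ℝ} (hd : ∀ i, 0 ≤ d i) :
    ∀ p, 1 ≤ p → p ≤ m → 0 < ptrace p (S + Matrix.diagonal d) := by
  have key : ∀ s : Finset ι, (S + ∑ i ∈ s, Matrix.single i i (d i)).IsHermitian ∧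
      ∀ p, 1 ≤ p → p ≤ m → 0 < ptrace p (S + ∑ i ∈ s, Matrix.single i i (d i)) := by
    intro s
    induction s using Finset.induction_on with
    | empty => simpa using ⟨hS, hpos⟩
    | insert i s hi ih =>
      rw [Finset.sum_insert hi, add_comm (Matrix.single i i (d i)), ← add_assoc]
      refine ⟨ih.1.add (by ext j k; simp [Matrix.single_apply, and_comm]), ?_⟩
      rintro (_ | p) h1 hp
      · omega
      · rw [ptrace_succ_add_single]
        have h2 := ih.2 (p + 1) h1 hp
        have h3 := ptraceAvoiding_pos ih.1 ih.2 i hp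
        nlinarith [hd i, mul_nonneg (hd i) h3.le]
  rw [← Matrix.sum_single_eq_diagonal]
  exact (key Finset.univ).2

/-- The Gårding cone is stable under adding positive semidefinite matrices. -/
theorem ptrace_add_posSemidef_pos {S P : Matrix ι ι ℝ} (hS : S.IsHermitian) {m : ℕ}
    (hpos : ∀ p, 1 ≤ p → p ≤ m → 0 < ptrace p S) (hP : P.PosSemidef) :
    ∀ p, 1 ≤ p → p ≤ m → 0 < ptrace p (S + P) := by
  set U : Matrix ι ι ℝ := (hP.1.eigenvectorUnitary : Matrix ι ι ℝ) with hU
  have hUU : U * star U = 1 := Unitary.coe_mul_star_self _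
  have hinv : ∀ (M : Matrix ι ι ℝ) p, ptrace p (star U * M * U) = ptrace p M := fun M p =>
    ptrace_eq_of_charpoly_eq (by
      rw [Matrix.charpoly_mul_comm, ← mul_assoc, hUU, one_mul]) p
  have hD : star U * P * U = Matrix.diagonal hP.1.eigenvalues := by
    have := hP.1.conjStarAlgAut_star_eigenvectorUnitary
    rw [Unitary.conjStarAlgAut_star_apply] at this
    simpa using this
  have hH : (star U * S * U).IsHermitian := Matrix.isHermitian_conjTranspose_mul_mul U hS
  intro p h1 hp
  have h := ptrace_add_diagonal_pos hH (fun q h1 hq => by rw [hinv]; exact hpos q h1 hq)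
    hP.eigenvalues_nonneg p h1 hp
  rwa [← hD, ← add_mul, ← mul_add, hinv] at h

theorem ptrace_submatrix_castSucc {n : ℕ} (p : ℕ) (S : Matrix (Fin (n + 1)) (Fin (n + 1)) ℝ) :
    ptrace p (S.submatrix Fin.castSucc Fin.castSucc) = ptraceAvoiding (Fin.last n) p S := by
  have huniv : (Finset.univ : Finset (Fin (n + 1))).erase (Fin.last n) =
      Finset.univ.map Fin.castSuccEmb := by
    ext j
    refine Fin.lastCases ?_ (fun j => ?_) j
    · simp [Fin.castSucc_ne_last]
    · simp [Fin.castSucc_ne_last]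
  rw [ptrace_eq, ptraceAvoiding, huniv, Finset.powersetCard_map, Finset.sum_map]
  refine Finset.sum_congr rfl fun t _ => ?_
  exact Matrix.det_submatrix_equiv_self (t.equivMap Fin.castSuccEmb)
    (S.submatrix (Subtype.val : {x // x ∈ t.map Fin.castSuccEmb} → _) Subtype.val)

end Cone

/-- let `S` be an `(n+1) × (n+1)` matrix in `K_m(n+1)` with `n ≥ 1` and
`2 ≤ m ≤ n+1`. Let `S'` be the principal submatrix of `S` obtained by deleting the last
row and column, let `A` be a real symmetric `n × n` matrix, and `λ ≤ 0` a real number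
such that `S' + λ A` is negative semidefinite. Then `λ < 0` and `A ∈ K_{m-1}(n)`. -/
theorem subbarrier_kernel_forces_convexity (n m : ℕ) (hn : 1 ≤ n)
    (h2 : 2 ≤ m) (hm : m ≤ n + 1)
    (S : Matrix (Fin (n + 1)) (Fin (n + 1)) ℝ) (hS : S ∈ gardingCone (n + 1) m)
    (A : Matrix (Fin n) (Fin n) ℝ) (hA : A.IsSymm)
    (lam : ℝ) (hlam : lam ≤ 0)
    (hneg : (-(S.submatrix Fin.castSucc Fin.castSucc + lam • A)).PosSemidef) :
    lam < 0 ∧ A ∈ gardingCone n (m - 1) := by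
  obtain ⟨hSs, hSp⟩ := hS
  have hSh : S.IsHermitian := by rwa [Matrix.isHermitian_iff_isSymm]
  have hS' : (S.submatrix Fin.castSucc Fin.castSucc).IsHermitian :=
    hSh.submatrix _
  have hpos : ∀ p, 1 ≤ p → p ≤ m - 1 →
      0 < ptrace p (S.submatrix Fin.castSucc Fin.castSucc) := fun p _ hp => by
    rw [ptrace_submatrix_castSucc]
    exact ptraceAvoiding_pos hSh hSp _ (by omega)
  have hA' : ∀ p, 1 ≤ p → p ≤ m - 1 → 0 < (-lam) ^ p * ptrace p A := by
    intro p h1 hp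
    have h := ptrace_add_posSemidef_pos hS' hpos hneg p h1 hp
    rwa [neg_add, add_neg_cancel_left, ← neg_smul, ptrace_smul] at h
  have hlt : lam < 0 := by
    refine lt_of_le_of_ne hlam ?_
    rintro rfl
    simpa using hA' 1 le_rfl (by omega)
  exact ⟨hlt, hA, fun p h1 hp =>
    pos_of_mul_pos_right (hA' p h1 hp) (pow_nonneg (by linarith) p)⟩
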